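/- arXiv:2110.07190 — 7 statements merged into one kernel-verified Lean document; each statement's English description precedes it below -/
import Mathlib

section
/- For every W ∈ ℝ^{c×c} and every α ∈ (0,1): (1/(1−α)) · E_splits[ ‖Y_out − M_out·P·Ỹ_in·W‖_F² ] = ‖Y_tr − M_tr·(P−C)·Y_tr·W‖_F² + ((1−α)/α)·‖Γ·W‖_F², where Γ = (diag(P̂ᵀP̂) − Ĉ²)^{1/2} · Y_tr and the square root exists because diag(P̂ᵀP̂) − Ĉ² is a diagonal matrix with nonnegative entries. -/
open Matrix Finset

/-- Training mask matrix: diagonal, 1 on the first `m` nodes. -/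
noncomputable def trainMask (n m : ℕ) : Matrix (Fin n) (Fin n) ℝ :=
  Matrix.diagonal fun i => if (i : ℕ) < m then 1 else 0

/-- Input mask matrix determined by Bernoulli draws `r : Fin m → Bool`. -/
noncomputable def inMask (n m : ℕ) (r : Fin m → Bool) : Matrix (Fin n) (Fin n) ℝ :=
  Matrix.diagonal fun i => if h : (i : ℕ) < m then (if r ⟨i, h⟩ then 1 else 0) else 0

/-- Probability weight of a split `r` under iid Bernoulli(α). -/
noncomputable def splitWeight (m : ℕ) (α : ℝ) (r : Fin m → Bool) : ℝ :=
  ∏ i : Fin m, if r i then α else 1 - α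

/-- Squared Frobenius norm. -/
noncomputable def frobSq {n c : ℕ} (A : Matrix (Fin n) (Fin c) ℝ) : ℝ :=
  ∑ i, ∑ j, (A i j) ^ 2

/-- Diagonal part of a square matrix. -/
noncomputable def diagPart {n : ℕ} (A : Matrix (Fin n) (Fin n) ℝ) :
    Matrix (Fin n) (Fin n) ℝ :=
  Matrix.diagonal fun i => A i i


lemma lt_momA (α : ℝ) (m : ℕ) : ∀ (a : Fin m → ℝ) (y : ℝ),
    ∑ r : Fin m → Bool, splitWeight m α r * (y - ∑ k, a k * (if r k then 1 else 0)) ^ 2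
      = (y - α * ∑ k, a k) ^ 2 + α * (1 - α) * ∑ k, a k ^ 2 := by
  induction m with
  | zero => intro a y; simp [splitWeight]
  | succ m ih =>
    intro a y
    rw [← (Fin.consEquiv (fun _ => Bool)).sum_comp, Fintype.sum_prod_type]
    have h1 := ih (fun k => a k.succ) (y - a 0)
    have h2 := ih (fun k => a k.succ) y
    simp only [splitWeight] at h1 h2 ⊢
    simp only [Fintype.sum_bool, Fin.consEquiv_apply, Fin.prod_univ_succ, Fin.sum_univ_succ,
      Fin.cons_zero, Fin.cons_succ, if_true, Bool.false_eq_true, if_false, mul_assoc,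
      ← Finset.mul_sum, mul_one, mul_zero, zero_add, ← sub_sub]
    rw [h1, sub_zero, h2]
    ring

lemma lt_momB (α : ℝ) (m : ℕ) (i : Fin m) (a : Fin m → ℝ) (y : ℝ) :
    ∑ r : Fin m → Bool, splitWeight m α r *
        ((1 - (if r i then 1 else 0)) * (y - ∑ k, a k * (if r k then 1 else 0))) ^ 2
      = (1 - α) * ((y - α * (∑ k, a k - a i)) ^ 2
          + α * (1 - α) * (∑ k, a k ^ 2 - a i ^ 2)) := by
  cases m with
  | zero => exact i.elim0
  | succ m =>
    rw [← (Fin.insertNthEquiv (fun _ => Bool) i).sum_comp, Fintype.sum_prod_type]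
    have h2 := lt_momA α m (fun k => a (i.succAbove k)) y
    simp only [splitWeight] at h2 ⊢
    simp only [Fintype.sum_bool, Fin.insertNthEquiv_apply, Fin.prod_univ_succAbove _ i,
      Fin.sum_univ_succAbove _ i, Fin.insertNth_apply_same, Fin.insertNth_apply_succAbove,
      if_true, Bool.false_eq_true, if_false, mul_assoc, sub_self, zero_mul, mul_zero,
      ← Finset.mul_sum, zero_add, sub_zero, one_mul, ne_eq, OfNat.ofNat_ne_zero,
      not_false_eq_true, zero_pow, Finset.sum_const_zero, add_sub_cancel_left]
    rw [h2]
    ring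

/-- **Theorem 1 (label trick as regularizer, no features).**
For every `W ∈ ℝ^{c×c}` and `α ∈ (0,1)`,
`(1/(1-α)) · E_splits ‖Y_out − M_out P Ỹ_in W‖_F² =
  ‖Y_tr − M_tr (P−C) Y_tr W‖_F² + ((1−α)/α)·‖Γ W‖_F²`
with `Γ = (diag(P̂ᵀP̂) − Ĉ²)^{1/2} Y_tr`. -/
theorem label_trick_regression (n m c : ℕ) (hm : 1 ≤ m) (hmn : m ≤ n) (hc : 1 ≤ c)
    (Y : Matrix (Fin n) (Fin c) ℝ) (P : Matrix (Fin n) (Fin n) ℝ)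
    (W : Matrix (Fin c) (Fin c) ℝ) (α : ℝ) (hα0 : 0 < α) (hα1 : α < 1) :
    let Mtr := trainMask n m
    let Ytr := Mtr * Y
    let C := diagPart P
    let Phat := Mtr * P * Mtr
    let Chat := diagPart Phat
    let Γ := (Matrix.diagonal fun i =>
        Real.sqrt ((Phatᵀ * Phat) i i - (Chat * Chat) i i)) * Ytr
    (1 / (1 - α)) *
        (∑ r : Fin m → Bool, splitWeight m α r *
          frobSq ((Mtr - inMask n m r) * Y
            - (Mtr - inMask n m r) * P * ((1 / α) • (inMask n m r * Y)) * W))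
      = frobSq (Ytr - Mtr * (P - C) * Ytr * W) + ((1 - α) / α) * frobSq (Γ * W) := by
  obtain ⟨d, rfl⟩ := Nat.exists_eq_add_of_le hmn
  intro Mtr Ytr C Phat Chat Γ
  have h1α : (1 - α) ≠ 0 := by linarith
  have hα : α ≠ 0 := hα0.ne'
  set Z := Y * W with hZ
  have eL : ∀ r : Fin m → Bool, frobSq ((Mtr - inMask (m + d) m r) * Y
            - (Mtr - inMask (m + d) m r) * P * ((1 / α) • (inMask (m + d) m r * Y)) * W)
      = ∑ i : Fin m, ∑ j, ((1 - (if r i then 1 else 0)) * (Y (Fin.castAdd d i) j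
          - ∑ k : Fin m, (P (Fin.castAdd d i) (Fin.castAdd d k) * Z (Fin.castAdd d k) j / α)
              * (if r k then 1 else 0))) ^ 2 := by
    intro r
    have : (Mtr - inMask (m + d) m r) * Y
            - (Mtr - inMask (m + d) m r) * P * ((1 / α) • (inMask (m + d) m r * Y)) * W
        = (Mtr - inMask (m + d) m r) * (Y - P * ((1 / α) • (inMask (m + d) m r * Z))) := by
      simp only [hZ, Matrix.mul_sub, Matrix.mul_assoc, Matrix.smul_mul, Matrix.mul_smul]
    rw [this]
    simp only [Mtr, trainMask, inMask, Matrix.diagonal_sub, frobSq, Matrix.diagonal_mul,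
      Matrix.sub_apply, Matrix.mul_apply (M := P), Matrix.smul_apply, Fin.sum_univ_add]
    simp
    refine Finset.sum_congr rfl fun i _ => Finset.sum_congr rfl fun j _ => ?_
    congr 3
    refine Finset.sum_congr rfl fun k _ => ?_
    split_ifs <;> ring
  have eR : frobSq (Ytr - Mtr * (P - C) * Ytr * W) = ∑ i : Fin m, ∑ j, (Y (Fin.castAdd d i) j
      - (∑ k : Fin m, P (Fin.castAdd d i) (Fin.castAdd d k) * Z (Fin.castAdd d k) j
        - P (Fin.castAdd d i) (Fin.castAdd d i) * Z (Fin.castAdd d i) j)) ^ 2 := by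
    have : Ytr - Mtr * (P - C) * Ytr * W = Mtr * (Y - (P * (Mtr * Z) - C * (Mtr * Z))) := by
      simp only [Ytr, hZ, Matrix.mul_sub, Matrix.sub_mul, Matrix.mul_assoc]
    rw [this]
    simp only [C, diagPart, Mtr, trainMask, frobSq, Matrix.diagonal_mul,
      Matrix.sub_apply, Matrix.mul_apply (M := P), Fin.sum_univ_add]
    simp
  have hD : ∀ k : Fin m, (Phatᵀ * Phat) (Fin.castAdd d k) (Fin.castAdd d k)
      - (Chat * Chat) (Fin.castAdd d k) (Fin.castAdd d k)
      = ∑ i : Fin m, P (Fin.castAdd d i) (Fin.castAdd d k) ^ 2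
        - P (Fin.castAdd d k) (Fin.castAdd d k) ^ 2 := by
    intro k
    simp only [Chat, diagPart, Phat, Mtr, trainMask, Matrix.diagonal_mul_diagonal,
      Matrix.diagonal_apply_eq, Matrix.mul_apply (M := (_)ᵀ), Matrix.transpose_apply,
      Matrix.diagonal_mul, Matrix.mul_diagonal, Fin.sum_univ_add]
    simp [sq]
  have eG : frobSq (Γ * W) = ∑ k : Fin m, ∑ j,
      (∑ i : Fin m, P (Fin.castAdd d i) (Fin.castAdd d k) ^ 2
        - P (Fin.castAdd d k) (Fin.castAdd d k) ^ 2) * Z (Fin.castAdd d k) j ^ 2 := by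
    have : Γ * W = (Matrix.diagonal fun i =>
        Real.sqrt ((Phatᵀ * Phat) i i - (Chat * Chat) i i)) * (Mtr * Z) := by
      simp only [Γ, Ytr, hZ, Matrix.mul_assoc]
    rw [this]
    simp only [frobSq, Matrix.diagonal_mul, Fin.sum_univ_add, hD, mul_pow, Mtr, trainMask]
    simp
    refine Finset.sum_congr rfl fun k _ => Finset.sum_congr rfl fun j _ => ?_
    rw [Real.sq_sqrt]
    exact sub_nonneg.2 (Finset.single_le_sum
      (f := fun i : Fin m => P (Fin.castAdd d i) (Fin.castAdd d k) ^ 2)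
      (fun i _ => sq_nonneg _) (Finset.mem_univ k))
  have eG2 : frobSq (Γ * W) = ∑ i : Fin m, ∑ j,
      (∑ k : Fin m, (P (Fin.castAdd d i) (Fin.castAdd d k) * Z (Fin.castAdd d k) j) ^ 2
        - (P (Fin.castAdd d i) (Fin.castAdd d i) * Z (Fin.castAdd d i) j) ^ 2) := by
    rw [eG]
    simp only [sub_mul, Finset.sum_sub_distrib, mul_pow, Finset.sum_mul]
    congr 1
    rw [Finset.sum_comm]
    conv_rhs => rw [Finset.sum_comm]
    refine Finset.sum_congr rfl fun j _ => Finset.sum_comm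
  rw [eR, eG2]
  simp only [eL, Finset.mul_sum (s := (Finset.univ : Finset (Fin m)))]
  rw [Finset.sum_comm, Finset.mul_sum, ← Finset.sum_add_distrib]
  refine Finset.sum_congr rfl fun i _ => ?_
  simp only [Finset.mul_sum (s := (Finset.univ : Finset (Fin c)))]
  rw [Finset.sum_comm, Finset.mul_sum, ← Finset.sum_add_distrib]
  refine Finset.sum_congr rfl fun j _ => ?_
  rw [lt_momB]
  simp only [div_pow, ← Finset.sum_div]
  field_simp
end

section
/- For every X ∈ ℝ^{n×d}, W_x ∈ ℝ^{d×c}, W_y ∈ ℝ^{c×c} and every α ∈ (0,1): (1/(1−α)) · E_splits[ ‖Y_out − M_out·P·X·W_x − M_out·P·Ỹ_in·W_y‖_F² ] = ‖Y_tr − M_tr·P·X·W_x − M_tr·(P−C)·Y_tr·W_y‖_F² + ((1−α)/α)·‖Γ·W_y‖_F², where Γ = (diag(P̂ᵀP̂) − Ĉ²)^{1/2} · Y_tr. -/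
open Matrix Finset

/-- Indicator of a draw. -/
noncomputable def bInd (b : Bool) : ℝ := if b then 1 else 0

lemma bInd_sq (b : Bool) : bInd b * bInd b = bInd b := by
  cases b <;> simp [bInd]

lemma moment {m : ℕ} (α : ℝ) (S : Finset (Fin m)) :
    ∑ r : Fin m → Bool, splitWeight m α r * ∏ i ∈ S, bInd (r i) = α ^ S.card := by
  have h1 : ∀ r : Fin m → Bool, splitWeight m α r * ∏ i ∈ S, bInd (r i)
      = ∏ i, ((if r i then α else 1 - α) * if i ∈ S then bInd (r i) else 1) := by
    intro r
    rw [Finset.prod_mul_distrib, splitWeight]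
    congr 1
    simp
  simp_rw [h1]
  rw [← Fintype.prod_sum (fun (i : Fin m) (b : Bool) =>
    ((if b then α else 1 - α) * if i ∈ S then bInd b else 1))]
  have h2 : ∀ i : Fin m, ∑ b : Bool, ((if b then α else 1 - α) * if i ∈ S then bInd b else 1)
      = if i ∈ S then α else 1 := by
    intro i
    by_cases hi : i ∈ S <;> simp [hi, bInd]
  simp_rw [h2]
  simp

lemma moment0 {m : ℕ} (α : ℝ) :
    ∑ r : Fin m → Bool, splitWeight m α r = 1 := by
  simpa using moment α (∅ : Finset (Fin m))

lemma moment1 {m : ℕ} (α : ℝ) (i : Fin m) :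
    ∑ r : Fin m → Bool, splitWeight m α r * bInd (r i) = α := by
  simpa using moment α ({i} : Finset (Fin m))

lemma moment2 {m : ℕ} (α : ℝ) (i j : Fin m) (h : i ≠ j) :
    ∑ r : Fin m → Bool, splitWeight m α r * (bInd (r i) * bInd (r j)) = α ^ 2 := by
  have := moment α ({i, j} : Finset (Fin m))
  rw [Finset.card_pair h] at this
  simpa [Finset.prod_pair h] using this

lemma moment3 {m : ℕ} (α : ℝ) (i j k : Fin m) (h : i ≠ j) (h' : i ≠ k) (h'' : j ≠ k) :
    ∑ r : Fin m → Bool, splitWeight m α r * (bInd (r i) * (bInd (r j) * bInd (r k)))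
      = α ^ 3 := by
  have := moment α ({i, j, k} : Finset (Fin m))
  rw [Finset.card_eq_three.mpr ⟨i, j, k, h, h', h'', rfl⟩] at this
  have e : ∀ r : Fin m → Bool, ∏ x ∈ ({i, j, k} : Finset (Fin m)), bInd (r x)
      = bInd (r i) * (bInd (r j) * bInd (r k)) := by
    intro r
    rw [Finset.prod_insert (by simp [h, h']), Finset.prod_pair h'']
  simpa [e] using this

lemma core {m : ℕ} (α a : ℝ) (i : Fin m) (b : Fin m → ℝ) (hb : b i = 0) :
    ∑ r : Fin m → Bool, splitWeight m α r *
        ((1 - bInd (r i)) * (a - ∑ j, b j * bInd (r j))) ^ 2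
      = (1 - α) * ((a - α * ∑ j, b j) ^ 2 + α * (1 - α) * ∑ j, b j ^ 2) := by
  have e1 : ∀ r : Fin m → Bool, splitWeight m α r *
        ((1 - bInd (r i)) * (a - ∑ j, b j * bInd (r j))) ^ 2
      = a ^ 2 * (splitWeight m α r - splitWeight m α r * bInd (r i))
        - 2 * a * ∑ j, b j * (splitWeight m α r * bInd (r j)
            - splitWeight m α r * (bInd (r i) * bInd (r j)))
        + ∑ j, ∑ k, b j * b k * (splitWeight m α r * (bInd (r j) * bInd (r k))
            - splitWeight m α r * (bInd (r i) * (bInd (r j) * bInd (r k)))) := by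
    intro r
    have s1 : ∑ j, b j * (splitWeight m α r * bInd (r j)
            - splitWeight m α r * (bInd (r i) * bInd (r j)))
        = splitWeight m α r * (1 - bInd (r i)) * ∑ j, b j * bInd (r j) := by
      rw [Finset.mul_sum]
      exact Finset.sum_congr rfl fun j _ => by ring
    have s2 : ∑ j, ∑ k, b j * b k * (splitWeight m α r * (bInd (r j) * bInd (r k))
            - splitWeight m α r * (bInd (r i) * (bInd (r j) * bInd (r k))))
        = splitWeight m α r * (1 - bInd (r i)) *
          ((∑ j, b j * bInd (r j)) * ∑ j, b j * bInd (r j)) := by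
      rw [Finset.sum_mul_sum, Finset.mul_sum]
      refine Finset.sum_congr rfl fun j _ => ?_
      rw [Finset.mul_sum]
      exact Finset.sum_congr rfl fun k _ => by ring
    rw [s1, s2]
    have := bInd_sq (r i)
    linear_combination splitWeight m α r * (a - ∑ j, b j * bInd (r j)) ^ 2 * this
  simp_rw [e1]
  rw [Finset.sum_add_distrib, Finset.sum_sub_distrib, ← Finset.mul_sum, ← Finset.mul_sum,
    Finset.sum_sub_distrib, moment0, moment1, Finset.sum_comm]
  have t1 : ∀ j, ∑ r : Fin m → Bool, b j * (splitWeight m α r * bInd (r j)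
            - splitWeight m α r * (bInd (r i) * bInd (r j))) = (1 - α) * α * b j := by
    intro j
    by_cases hj : i = j
    · subst hj; simp [hb]
    · rw [← Finset.mul_sum, Finset.sum_sub_distrib, moment1, moment2 α i j hj]; ring
  have t2 : ∑ r : Fin m → Bool, ∑ j, ∑ k, b j * b k *
        (splitWeight m α r * (bInd (r j) * bInd (r k))
            - splitWeight m α r * (bInd (r i) * (bInd (r j) * bInd (r k))))
      = ∑ j, ∑ k, ((1 - α) * α ^ 2 * (b j * b k)
          + if j = k then (1 - α) * α * (1 - α) * b j ^ 2 else 0) := by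
    rw [Finset.sum_comm]
    refine Finset.sum_congr rfl fun j _ => ?_
    rw [Finset.sum_comm]
    refine Finset.sum_congr rfl fun k _ => ?_
    rw [← Finset.mul_sum, Finset.sum_sub_distrib]
    by_cases hj : i = j
    · subst hj; simp [hb]
    by_cases hk : i = k
    · subst hk; simp [hb, Ne.symm hj]
    by_cases hjk : j = k
    · subst hjk
      simp_rw [bInd_sq]
      rw [moment1, moment2 α i j hj]; simp only [if_true]; ring
    · rw [moment2 α j k hjk, moment3 α i j k hj hk hjk, if_neg hjk]; ring
  simp_rw [t1]
  rw [t2]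
  simp_rw [Finset.sum_add_distrib, ← Finset.mul_sum, ← Finset.sum_mul]
  simp only [Finset.sum_ite_eq, Finset.mem_univ, if_true]
  simp_rw [← Finset.mul_sum]
  ring

/-- **Corollary (label trick as regularizer, with node features).**
For every `X ∈ ℝ^{n×d}`, `W_x ∈ ℝ^{d×c}`, `W_y ∈ ℝ^{c×c}` and `α ∈ (0,1)`,
`(1/(1-α)) · E_splits ‖Y_out − M_out P X W_x − M_out P Ỹ_in W_y‖_F² =
  ‖Y_tr − M_tr P X W_x − M_tr (P−C) Y_tr W_y‖_F² + ((1−α)/α)·‖Γ W_y‖_F²`. -/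
theorem label_trick_regression_with_features (n m c d : ℕ)
    (hm : 1 ≤ m) (hmn : m ≤ n) (hc : 1 ≤ c) (hd : 1 ≤ d)
    (Y : Matrix (Fin n) (Fin c) ℝ) (P : Matrix (Fin n) (Fin n) ℝ)
    (X : Matrix (Fin n) (Fin d) ℝ) (Wx : Matrix (Fin d) (Fin c) ℝ)
    (Wy : Matrix (Fin c) (Fin c) ℝ) (α : ℝ) (hα0 : 0 < α) (hα1 : α < 1) :
    let Mtr := trainMask n m
    let Ytr := Mtr * Y
    let C := diagPart P
    let Phat := Mtr * P * Mtr
    let Chat := diagPart Phat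
    let Γ := (Matrix.diagonal fun i =>
        Real.sqrt ((Phatᵀ * Phat) i i - (Chat * Chat) i i)) * Ytr
    (1 / (1 - α)) *
        (∑ r : Fin m → Bool, splitWeight m α r *
          frobSq ((Mtr - inMask n m r) * Y
            - (Mtr - inMask n m r) * P * X * Wx
            - (Mtr - inMask n m r) * P * ((1 / α) • (inMask n m r * Y)) * Wy))
      = frobSq (Ytr - Mtr * P * X * Wx - Mtr * (P - C) * Ytr * Wy)
        + ((1 - α) / α) * frobSq (Γ * Wy) := by
  intro Mtr Ytr C Phat Chat Γ
  obtain ⟨k, rfl⟩ := Nat.exists_eq_add_of_le hmn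
  set Q := P * X * Wx with hQ
  set Z := Y * Wy with hZ
  have hα : α ≠ 0 := hα0.ne'
  have hα' : 1 - α ≠ 0 := by linarith
  have hMc : ∀ i : Fin m, (if ((Fin.castAdd k i : Fin (m + k)) : ℕ) < m then (1 : ℝ) else 0) = 1 := by
    intro i; simp
  -- left-hand side entries
  have L : ∀ r : Fin m → Bool, frobSq ((Mtr - inMask (m + k) m r) * Y
            - (Mtr - inMask (m + k) m r) * P * X * Wx
            - (Mtr - inMask (m + k) m r) * P * ((1 / α) • (inMask (m + k) m r * Y)) * Wy)
      = ∑ i : Fin m, ∑ l, ((1 - bInd (r i)) * ((Y (Fin.castAdd k i) l - Q (Fin.castAdd k i) l)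
          - ∑ j, (if j = i then 0 else
              P (Fin.castAdd k i) (Fin.castAdd k j) * Z (Fin.castAdd k j) l / α)
                * bInd (r j))) ^ 2 := by
    intro r
    have hM : (Mtr - inMask (m + k) m r) * Y
            - (Mtr - inMask (m + k) m r) * P * X * Wx
            - (Mtr - inMask (m + k) m r) * P * ((1 / α) • (inMask (m + k) m r * Y)) * Wy
        = (Mtr - inMask (m + k) m r) * (Y - Q - (1 / α) • (P * (inMask (m + k) m r * Z))) := by
      simp only [hQ, hZ, Matrix.mul_sub, Matrix.mul_assoc, Matrix.mul_smul, Matrix.smul_mul]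
    rw [hM]
    have hD : Mtr - inMask (m + k) m r = Matrix.diagonal fun i : Fin (m + k) =>
        (if (i : ℕ) < m then (1 : ℝ) else 0)
          - if h : (i : ℕ) < m then (if r ⟨i, h⟩ then 1 else 0) else 0 := by
      simp only [Mtr, trainMask, inMask, Matrix.diagonal_sub]
    rw [hD, inMask, frobSq, Fin.sum_univ_add]
    simp only [Matrix.diagonal_mul]
    have hz : ∑ i : Fin k, ∑ j : Fin c, (((if ((Fin.natAdd m i : Fin (m + k)) : ℕ) < m then (1 : ℝ) else 0)
          - if h : ((Fin.natAdd m i : Fin (m + k)) : ℕ) < m then (if r ⟨_, h⟩ then 1 else 0) else 0)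
          * (Y - Q - (1 / α) • (P * (Matrix.diagonal (fun i : Fin (m + k) =>
            if h : (i : ℕ) < m then (if r ⟨i, h⟩ then (1 : ℝ) else 0) else 0) * Z))) (Fin.natAdd m i) j) ^ 2 = 0 := by
      simp
    rw [hz, add_zero]
    refine Finset.sum_congr rfl fun i _ => Finset.sum_congr rfl fun l _ => ?_
    simp only [Matrix.sub_apply, Matrix.smul_apply, Matrix.mul_apply (M := P), Matrix.diagonal_mul,
      Fin.sum_univ_add]
    simp only [Fin.val_castAdd, Fin.is_lt, if_true, dif_pos, Fin.val_natAdd, smul_eq_mul]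
    have hneg : ∀ x : Fin k, ¬ (m + (x : ℕ) < m) := by intro x; omega
    simp only [hneg, dif_neg, not_false_eq_true, zero_mul, mul_zero, Finset.sum_const_zero,
      add_zero, Fin.eta]
    change ((1 - bInd (r i)) * (_ - 1 / α * ∑ x : Fin m, _ * (bInd (r x) * _))) ^ 2 = _
    congr 1
    rw [mul_sub, mul_sub _ (_ - _)]
    congr 1
    rw [Finset.mul_sum, Finset.mul_sum, Finset.mul_sum]
    refine Finset.sum_congr rfl fun j _ => ?_
    by_cases hj : j = i
    · subst hj
      rw [if_pos rfl]
      linear_combination (- 1 / α * P (Fin.castAdd k j) (Fin.castAdd k j)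
        * Z (Fin.castAdd k j) l) * bInd_sq (r j)
    · rw [if_neg hj]; ring
  have R1 : frobSq (Ytr - Mtr * P * X * Wx - Mtr * (P - C) * Ytr * Wy)
      = ∑ i : Fin m, ∑ l, ((Y (Fin.castAdd k i) l - Q (Fin.castAdd k i) l)
          - ∑ j, (if j = i then 0 else
              P (Fin.castAdd k i) (Fin.castAdd k j) * Z (Fin.castAdd k j) l)) ^ 2 := by
    have hM : Ytr - Mtr * P * X * Wx - Mtr * (P - C) * Ytr * Wy
        = Mtr * (Y - Q - (P - C) * (Mtr * Z)) := by
      simp only [Ytr, hQ, hZ, Matrix.mul_sub, Matrix.sub_mul, Matrix.mul_assoc]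
    rw [hM]
    simp only [Mtr, trainMask, frobSq, Fin.sum_univ_add, Matrix.diagonal_mul]
    have hneg : ∀ x : Fin k, ¬ (m + (x : ℕ) < m) := by intro x; omega
    simp only [Matrix.sub_apply, Matrix.mul_apply (M := (P - C)), Matrix.diagonal_mul, Fin.sum_univ_add,
      Fin.val_castAdd, Fin.is_lt, if_true, Fin.val_natAdd, hneg, if_false, zero_mul, mul_zero,
      Finset.sum_const_zero, add_zero, one_mul, ne_eq, OfNat.ofNat_ne_zero, not_false_eq_true,
      zero_pow]
    refine Finset.sum_congr rfl fun i _ => Finset.sum_congr rfl fun l _ => ?_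
    congr 2
    refine Finset.sum_congr rfl fun j _ => ?_
    by_cases hj : j = i
    · subst hj; simp [C, diagPart]
    · have : Fin.castAdd k i ≠ Fin.castAdd k j := by
        intro h; exact hj (Fin.castAdd_injective m k h).symm
      simp [C, diagPart, hj, Matrix.diagonal_apply_ne _ this]
  have R2 : frobSq (Γ * Wy)
      = ∑ j : Fin m, ∑ l, (∑ i : Fin m, if j = i then 0 else
              P (Fin.castAdd k i) (Fin.castAdd k j) ^ 2) * Z (Fin.castAdd k j) l ^ 2 := by
    have hM : Γ * Wy = (Matrix.diagonal fun i =>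
        Real.sqrt ((Phatᵀ * Phat) i i - (Chat * Chat) i i)) * (Mtr * Z) := by
      simp only [Γ, Ytr, hZ, Matrix.mul_assoc]
    have hneg : ∀ x : Fin k, ¬ (m + (x : ℕ) < m) := by intro x; omega
    have hg : ∀ j : Fin m, (Phatᵀ * Phat) (Fin.castAdd k j) (Fin.castAdd k j)
        - (Chat * Chat) (Fin.castAdd k j) (Fin.castAdd k j)
        = ∑ i : Fin m, if j = i then 0 else P (Fin.castAdd k i) (Fin.castAdd k j) ^ 2 := by
      intro j
      have h1 : (Phatᵀ * Phat) (Fin.castAdd k j) (Fin.castAdd k j)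
          = ∑ i : Fin m, P (Fin.castAdd k i) (Fin.castAdd k j) ^ 2 := by
        rw [Matrix.mul_apply]
        simp [Phat, Mtr, trainMask, Matrix.diagonal_mul,
          Matrix.mul_diagonal, Fin.sum_univ_add, pow_two]
      have h2 : (Chat * Chat) (Fin.castAdd k j) (Fin.castAdd k j)
          = ∑ i : Fin m, if j = i then P (Fin.castAdd k i) (Fin.castAdd k j) ^ 2 else 0 := by
        simp [Chat, diagPart, Phat, Mtr, trainMask, Matrix.diagonal_mul,
          Matrix.mul_diagonal, pow_two]
      rw [h1, h2, ← Finset.sum_sub_distrib]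
      refine Finset.sum_congr rfl fun i _ => ?_
      split_ifs <;> simp
    rw [hM]
    simp only [Mtr, trainMask, frobSq, Fin.sum_univ_add, Matrix.diagonal_mul]
    simp only [Fin.val_castAdd, Fin.is_lt, if_true, Fin.val_natAdd, hneg, if_false, zero_mul,
      mul_zero, Finset.sum_const_zero, add_zero, one_mul, ne_eq, OfNat.ofNat_ne_zero,
      not_false_eq_true, zero_pow]
    refine Finset.sum_congr rfl fun j _ => Finset.sum_congr rfl fun l _ => ?_
    rw [mul_pow, hg, Real.sq_sqrt]
    exact Finset.sum_nonneg fun i _ => by split_ifs <;> positivity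
  simp_rw [L]
  rw [R1, R2]
  simp_rw [Finset.mul_sum (Finset.univ : Finset (Fin m)), Finset.mul_sum (Finset.univ : Finset (Fin c))]
  rw [Finset.sum_comm]
  have K : ∀ i : Fin m, ∑ r : Fin m → Bool, ∑ l, splitWeight m α r *
      ((1 - bInd (r i)) * ((Y (Fin.castAdd k i) l - Q (Fin.castAdd k i) l)
          - ∑ j, (if j = i then 0 else
              P (Fin.castAdd k i) (Fin.castAdd k j) * Z (Fin.castAdd k j) l / α)
                * bInd (r j))) ^ 2
      = (1 - α) * (∑ l, ((Y (Fin.castAdd k i) l - Q (Fin.castAdd k i) l)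
          - ∑ j, (if j = i then 0 else
              P (Fin.castAdd k i) (Fin.castAdd k j) * Z (Fin.castAdd k j) l)) ^ 2
        + ∑ l, ∑ j, (1 - α) / α * ((if j = i then 0 else
              P (Fin.castAdd k i) (Fin.castAdd k j) ^ 2) * Z (Fin.castAdd k j) l ^ 2)) := by
    intro i
    rw [Finset.sum_comm, ← Finset.sum_add_distrib, Finset.mul_sum]
    refine Finset.sum_congr rfl fun l _ => ?_
    rw [core α _ i _ (by simp)]
    congr 2
    · congr 2
      rw [Finset.mul_sum]
      refine Finset.sum_congr rfl fun j _ => ?_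
      split_ifs
      · simp
      · field_simp
    · rw [Finset.mul_sum]
      refine Finset.sum_congr rfl fun j _ => ?_
      split_ifs
      · simp
      · field_simp
  simp_rw [K]
  rw [← Finset.mul_sum, ← mul_assoc, one_div_mul_cancel hα', one_mul, Finset.sum_add_distrib]
  congr 1
  rw [Finset.sum_congr rfl fun i _ => Finset.sum_comm, Finset.sum_comm]
  refine Finset.sum_congr rfl fun j _ => ?_
  rw [Finset.sum_comm]
  refine Finset.sum_congr rfl fun l _ => ?_
  rw [Finset.sum_mul, Finset.mul_sum]
end

section
/- Let S ∈ ℝ^{n×n} be symmetric with L = I_n − S positive semidefinite, let λ ∈ (0,1) and Y_tr ∈ ℝ^{n×c}. Then I_n − λS is invertible, and F* = (1−λ)·(I_n − λS)^{−1}·Y_tr is the unique minimizer over F ∈ ℝ^{n×c} of the label propagation energy E(F) = (1−λ)·‖F − Y_tr‖_F² + λ·tr(Fᵀ·L·F). -/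
open Matrix Finset

/-- **Closed-form solution of the label propagation energy.**
If `S` is symmetric with `L = I − S` positive semidefinite and `λ ∈ (0,1)`, then
`I − λS` is invertible and `F* = (1−λ)·(I − λS)⁻¹·Y_tr` is the unique minimizer of
`E(F) = (1−λ)·‖F − Y_tr‖_F² + λ·tr(Fᵀ L F)`. -/
theorem label_propagation_energy_minimizer (n c : ℕ) (hn : 1 ≤ n) (hc : 1 ≤ c)
    (S : Matrix (Fin n) (Fin n) ℝ) (hS : S.IsSymm)
    (hL : ((1 : Matrix (Fin n) (Fin n) ℝ) - S).PosSemidef)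
    (lam : ℝ) (hlam0 : 0 < lam) (hlam1 : lam < 1)
    (Ytr : Matrix (Fin n) (Fin c) ℝ) :
    let L : Matrix (Fin n) (Fin n) ℝ := 1 - S
    let E : Matrix (Fin n) (Fin c) ℝ → ℝ := fun F =>
      (1 - lam) * (∑ i, ∑ j, (F i j - Ytr i j) ^ 2) + lam * Matrix.trace (Fᵀ * L * F)
    let Fstar : Matrix (Fin n) (Fin c) ℝ :=
      (1 - lam) • (((1 : Matrix (Fin n) (Fin n) ℝ) - lam • S)⁻¹ * Ytr)
    IsUnit ((1 : Matrix (Fin n) (Fin n) ℝ) - lam • S) ∧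
      ∀ F : Matrix (Fin n) (Fin c) ℝ, F ≠ Fstar → E Fstar < E F := by
  intro L E Fstar
  have hM : (1 : Matrix (Fin n) (Fin n) ℝ) - lam • S = (1 - lam) • 1 + lam • L := by
    simp only [L, smul_sub, sub_smul, one_smul]
    abel
  have hPD : ((1 : Matrix (Fin n) (Fin n) ℝ) - lam • S).PosDef := by
    rw [hM]
    exact (Matrix.PosDef.one.smul (sub_pos.2 hlam1)).add_posSemidef (hL.smul hlam0.le)
  have hU := hPD.isUnit
  refine ⟨hU, fun F hF => ?_⟩
  have hLs : Lᵀ = L := by simp [L, hS.eq]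
  have hsum : ∀ A : Matrix (Fin n) (Fin c) ℝ,
      ∑ i, ∑ j, (A i j) ^ 2 = Matrix.trace (Aᵀ * A) := by
    intro A
    rw [Finset.sum_comm]
    simp [Matrix.trace, Matrix.mul_apply, sq]
  have hE : ∀ A, E A = (1 - lam) * Matrix.trace ((A - Ytr)ᵀ * (A - Ytr))
      + lam * Matrix.trace (Aᵀ * L * A) := by
    intro A
    rw [← hsum]
    rfl
  have hst : (1 - lam) • Fstar + lam • (L * Fstar) = (1 - lam) • Ytr := by
    have h1 : ((1 : Matrix (Fin n) (Fin n) ℝ) - lam • S) * Fstar = (1 - lam) • Ytr := by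
      simp only [Fstar, Matrix.mul_smul]
      rw [Matrix.mul_nonsing_inv_cancel_left _ _ ((Matrix.isUnit_iff_isUnit_det _).1 hU)]
    rw [hM, Matrix.add_mul, Matrix.smul_mul, Matrix.smul_mul, Matrix.one_mul] at h1
    exact h1
  obtain ⟨D, rfl⟩ : ∃ D, F = Fstar + D := ⟨F - Fstar, by abel⟩
  have hD : D ≠ 0 := by
    rintro rfl
    simp at hF
  have hL' : L.PosSemidef := hL
  clear_value Fstar E L
  have key : (1 - lam) * trace (Dᵀ * Fstar) + lam * trace (Dᵀ * (L * Fstar))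
      = (1 - lam) * trace (Dᵀ * Ytr) := by
    have := congrArg (fun X => trace (Dᵀ * X)) hst
    simpa [Matrix.mul_add, Matrix.mul_smul] using this
  have t1 : trace (Fstarᵀ * D) = trace (Dᵀ * Fstar) := by
    rw [← Matrix.trace_transpose]; simp
  have t2 : trace (Ytrᵀ * D) = trace (Dᵀ * Ytr) := by
    rw [← Matrix.trace_transpose]; simp
  have t3 : trace (Fstarᵀ * (L * D)) = trace (Dᵀ * (L * Fstar)) := by
    rw [← Matrix.trace_transpose]; simp [hLs, Matrix.mul_assoc]
  have hpos : 0 < trace (Dᵀ * D) := by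
    rw [← hsum]
    obtain ⟨i, j, hij⟩ : ∃ i j, D i j ≠ 0 := by
      by_contra! h
      exact hD (Matrix.ext h)
    refine Finset.sum_pos' (fun i _ => Finset.sum_nonneg fun j _ => sq_nonneg _)
      ⟨i, Finset.mem_univ _, Finset.sum_pos' (fun j _ => sq_nonneg _)
        ⟨j, Finset.mem_univ _, by positivity⟩⟩
  have hnn : 0 ≤ trace (Dᵀ * (L * D)) := by
    have := (hL'.conjTranspose_mul_mul_same D).trace_nonneg
    simpa [Matrix.conjTranspose_eq_transpose_of_trivial, Matrix.mul_assoc] using this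
  rw [hE, hE]
  simp only [Matrix.transpose_sub, Matrix.transpose_add, Matrix.add_mul, Matrix.mul_add,
    Matrix.sub_mul, Matrix.mul_sub, Matrix.trace_add, Matrix.trace_sub, Matrix.mul_assoc]
  rw [t1, t2, t3]
  have a1 := mul_pos (sub_pos.2 hlam1) hpos
  have a2 := mul_nonneg hlam0.le hnn
  nlinarith
end

section
/- For every α ∈ (0,1): E_splits[ M_in·P·M_in ] = α²·P̂ + (α−α²)·Ĉ, where P̂ = M_tr·P·M_tr and Ĉ = diag(P̂). -/
open Matrix Finset

/-- Moment of a product of Bernoulli indicators. -/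
theorem sum_splitWeight_prod (m : ℕ) (α : ℝ) (S : Finset (Fin m)) :
    ∑ r : Fin m → Bool, splitWeight m α r * ∏ i ∈ S, (if r i then (1 : ℝ) else 0)
      = α ^ S.card := by
  have h : ∀ r : Fin m → Bool,
      splitWeight m α r * ∏ i ∈ S, (if r i then (1 : ℝ) else 0)
        = ∏ i : Fin m, ((if r i then α else 1 - α) *
            (if i ∈ S then (if r i then (1 : ℝ) else 0) else 1)) := by
    intro r
    rw [Finset.prod_mul_distrib, Finset.prod_ite_mem, Finset.univ_inter, splitWeight]
  simp_rw [h]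
  have h2 := Finset.prod_univ_sum (fun _ : Fin m => (Finset.univ : Finset Bool))
    (fun i b => ((if b then α else 1 - α) *
            (if i ∈ S then (if b then (1 : ℝ) else 0) else 1)))
  rw [Fintype.piFinset_univ] at h2
  rw [← h2]
  have h3 : ∀ i : Fin m, ∑ b : Bool, ((if b then α else 1 - α) *
            (if i ∈ S then (if b then (1 : ℝ) else 0) else 1)) = if i ∈ S then α else 1 := by
    intro i
    by_cases hi : i ∈ S <;> simp [hi]
  simp_rw [h3]
  rw [Finset.prod_ite_mem, Finset.univ_inter, Finset.prod_const]

/-- **Second-moment identity:** `E_splits[M_in·P·M_in] = α²·P̂ + (α−α²)·Ĉ`,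
where `P̂ = M_tr·P·M_tr` and `Ĉ = diag(P̂)`. -/
theorem expectation_min_P_min (n m : ℕ) (hm : 1 ≤ m) (hmn : m ≤ n)
    (P : Matrix (Fin n) (Fin n) ℝ) (α : ℝ) (hα0 : 0 < α) (hα1 : α < 1) :
    let Phat := trainMask n m * P * trainMask n m
    let Chat : Matrix (Fin n) (Fin n) ℝ := Matrix.diagonal fun i => Phat i i
    (∑ r : Fin m → Bool, splitWeight m α r • (inMask n m r * P * inMask n m r))
      = α ^ 2 • Phat + (α - α ^ 2) • Chat := by
  intro Phat Chat
  ext i j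
  rw [Matrix.sum_apply]
  simp only [Phat, Chat, inMask, trainMask, Matrix.add_apply, Matrix.smul_apply, smul_eq_mul,
    Matrix.mul_diagonal, Matrix.diagonal_mul, Matrix.diagonal_apply]
  by_cases hi : (i : ℕ) < m
  · by_cases hj : (j : ℕ) < m
    · simp only [hi, hj, dite_true, if_true]
      by_cases hij : i = j
      · subst hij
        have h := sum_splitWeight_prod m α {⟨i, hi⟩}
        simp only [Finset.prod_singleton, Finset.card_singleton, pow_one] at h
        simp only [if_true]
        calc _ = ∑ r : Fin m → Bool,
              (splitWeight m α r * (if r ⟨i, hi⟩ then (1 : ℝ) else 0)) * P i i := by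
              refine Finset.sum_congr rfl fun r _ => ?_
              split_ifs <;> ring
          _ = _ := by
              rw [← Finset.sum_mul, h]; ring
      · have hne : (⟨i, hi⟩ : Fin m) ≠ ⟨j, hj⟩ := fun h => hij (Fin.ext (Fin.mk.inj h))
        have h := sum_splitWeight_prod m α {⟨i, hi⟩, ⟨j, hj⟩}
        simp only [Finset.prod_pair hne, Finset.card_pair hne] at h
        simp only [hij, if_false]
        calc _ = ∑ r : Fin m → Bool,
              (splitWeight m α r * ((if r ⟨i, hi⟩ then (1 : ℝ) else 0) *
                (if r ⟨j, hj⟩ then (1 : ℝ) else 0))) * P i j := by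
              refine Finset.sum_congr rfl fun r _ => ?_
              ring
          _ = _ := by
              rw [← Finset.sum_mul, h]; ring
    · have hij : i ≠ j := fun h => hj (h ▸ hi)
      simp [hj, hij]
  · simp [hi]
end

section
/- For every α ∈ (0,1): E_splits[ M_out·P·M_in ] = (α−α²)·(P̂ − Ĉ), where M_out = M_tr − M_in, P̂ = M_tr·P·M_tr and Ĉ = diag(P̂). Consequently, for every label matrix Y ∈ ℝ^{n×c} and W ∈ ℝ^{c×c}, E_splits[ M_out·P·(1/α)·M_in·Y·W ] = (1−α)·M_tr·(P − C)·Y_tr·W, where Y_tr = M_tr·Y and C = diag(P). -/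
open Matrix Finset

theorem split_cross (m : ℕ) (α : ℝ) (a b : Fin m) (hab : a ≠ b) :
    ∑ r : Fin m → Bool, splitWeight m α r *
      ((1 - (if r a then (1:ℝ) else 0)) * (if r b then (1:ℝ) else 0)) = α - α ^ 2 := by
  have key : ∀ r : Fin m → Bool, splitWeight m α r *
      ((1 - (if r a then (1:ℝ) else 0)) * (if r b then (1:ℝ) else 0)) =
      ∏ i : Fin m, ((fun (i : Fin m) (x : Bool) => (if x then α else 1 - α) *
        ((if i = a then (1 - (if x then (1:ℝ) else 0)) else 1) *
         (if i = b then (if x then (1:ℝ) else 0) else 1))) i (r i)) := by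
    intro r
    simp only [splitWeight, Finset.prod_mul_distrib, Finset.prod_ite_eq', Finset.mem_univ, if_true]
  rw [Finset.sum_congr rfl fun r _ => key r]
  refine (Fintype.prod_sum (fun (i : Fin m) (x : Bool) => (if x then α else 1 - α) *
        ((if i = a then (1 - (if x then (1:ℝ) else 0)) else 1) *
         (if i = b then (if x then (1:ℝ) else 0) else 1)))).symm.trans ?_
  have : ∀ i : Fin m, (∑ x : Bool, (if x then α else 1 - α) *
        ((if i = a then (1 - (if x then (1:ℝ) else 0)) else 1) *
         (if i = b then (if x then (1:ℝ) else 0) else 1))) =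
      (if i = a then 1 - α else 1) * (if i = b then α else 1) := by
    intro i
    by_cases h1 : i = a
    · have h2 : i ≠ b := fun h => hab (h1.symm.trans h)
      simp [h1, hab]
    · by_cases h2 : i = b <;> simp [h1, h2, hab.symm]
  rw [Finset.prod_congr rfl fun i _ => this i]
  simp only [Finset.prod_mul_distrib, Finset.prod_ite_eq', Finset.mem_univ, if_true]
  ring

theorem cross_first (n m : ℕ) (P : Matrix (Fin n) (Fin n) ℝ) (α : ℝ) :
    (∑ r : Fin m → Bool,
        splitWeight m α r • ((trainMask n m - inMask n m r) * P * inMask n m r))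
      = (α - α ^ 2) • (trainMask n m * P * trainMask n m -
        Matrix.diagonal fun i => (trainMask n m * P * trainMask n m) i i) := by
  ext i j
  simp only [Matrix.sum_apply, Matrix.smul_apply, Matrix.sub_apply, trainMask, inMask,
    Matrix.diagonal_sub, Matrix.mul_diagonal, Matrix.diagonal_mul, smul_eq_mul]
  by_cases hi : (i : ℕ) < m
  swap
  · simp [hi, Matrix.diagonal_apply]
  by_cases hj : (j : ℕ) < m
  swap
  · by_cases hij : i = j
    · exact absurd (hij ▸ hi) hj
    · simp [hj, Matrix.diagonal_apply, hij]
  by_cases hij : i = j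
  · subst hij
    simp only [hi, dite_true, if_true, Matrix.diagonal_apply_eq, sub_self, mul_zero]
    apply Finset.sum_eq_zero
    intro r _
    cases r ⟨i, hi⟩ <;> simp
  · have hne : (⟨i, hi⟩ : Fin m) ≠ ⟨j, hj⟩ := by
      intro h
      apply hij
      ext
      simpa using h
    simp only [hi, hj, dite_true, if_true, Matrix.diagonal_apply_ne _ hij]
    rw [← split_cross m α _ _ hne, Finset.sum_mul]
    apply Finset.sum_congr rfl
    intro r _
    ring

theorem mask_diag (n m : ℕ) (P : Matrix (Fin n) (Fin n) ℝ) :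
    trainMask n m * P * trainMask n m -
        (Matrix.diagonal fun i => (trainMask n m * P * trainMask n m) i i) =
    trainMask n m * (P - Matrix.diagonal fun i => P i i) * trainMask n m := by
  ext i j
  simp only [Matrix.sub_apply, trainMask, Matrix.mul_diagonal, Matrix.diagonal_mul]
  by_cases hij : i = j
  · subst hij
    simp
  · simp [Matrix.diagonal_apply_ne _ hij]

/-- **Cross-term identity:** `E_splits[M_out·P·M_in] = (α−α²)·(P̂ − Ĉ)`, and
consequently `E_splits[M_out·P·(1/α)·M_in·Y·W] = (1−α)·M_tr·(P−C)·Y_tr·W`. -/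
theorem expectation_mout_P_min (n m c : ℕ) (hm : 1 ≤ m) (hmn : m ≤ n) (hc : 1 ≤ c)
    (P : Matrix (Fin n) (Fin n) ℝ) (α : ℝ) (hα0 : 0 < α) (hα1 : α < 1) :
    let Mtr := trainMask n m
    let Phat := Mtr * P * Mtr
    let Chat : Matrix (Fin n) (Fin n) ℝ := Matrix.diagonal fun i => Phat i i
    let C : Matrix (Fin n) (Fin n) ℝ := Matrix.diagonal fun i => P i i
    ((∑ r : Fin m → Bool,
        splitWeight m α r • ((Mtr - inMask n m r) * P * inMask n m r))
      = (α - α ^ 2) • (Phat - Chat)) ∧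
    ∀ (Y : Matrix (Fin n) (Fin c) ℝ) (W : Matrix (Fin c) (Fin c) ℝ),
      (∑ r : Fin m → Bool,
        splitWeight m α r •
          ((Mtr - inMask n m r) * P * ((1 / α) • (inMask n m r)) * Y * W))
      = (1 - α) • (Mtr * (P - C) * (Mtr * Y) * W) := by
  intro Mtr Phat Chat C
  refine ⟨cross_first n m P α, ?_⟩
  intro Y W
  have h1 := cross_first n m P α
  rw [mask_diag] at h1
  have h2 : ∀ r : Fin m → Bool, splitWeight m α r •
          ((Mtr - inMask n m r) * P * ((1 / α) • (inMask n m r)) * Y * W) =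
      (1 / α) • (splitWeight m α r • ((trainMask n m - inMask n m r) * P * inMask n m r)
        * Y * W) := by
    intro r
    simp only [Matrix.mul_smul, Matrix.smul_mul]
    rw [smul_comm]
  rw [Finset.sum_congr rfl fun r _ => h2 r, ← Finset.smul_sum, ← Matrix.sum_mul,
    ← Matrix.sum_mul, h1]
  simp only [Matrix.smul_mul, smul_smul]
  have h3 : 1 / α * (α - α ^ 2) = 1 - α := by
    field_simp
  rw [h3, ← Matrix.mul_assoc (Mtr * (P - C)) Mtr Y]
end

section
/- For every α ∈ (0,1): E_splits[ M_in·Pᵀ·M_tr·P·M_in ] = α²·P̂ᵀ·P̂ + (α−α²)·diag(P̂ᵀ·P̂), where P̂ = M_tr·P·M_tr. -/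
open Matrix Finset

theorem moment_aux (m : ℕ) (α : ℝ) (a b : Fin m) :
    ∑ r : Fin m → Bool, splitWeight m α r *
      ((if r a then (1:ℝ) else 0) * (if r b then (1:ℝ) else 0)) = if a = b then α else α ^ 2 := by
  let g : Fin m → Bool → ℝ := fun i c => (if c then α else 1 - α) *
    ((if i = a then (if c then (1:ℝ) else 0) else 1) *
      (if i = b then (if c then (1:ℝ) else 0) else 1))
  have h1 : ∀ r : Fin m → Bool, splitWeight m α r *
      ((if r a then (1:ℝ) else 0) * (if r b then (1:ℝ) else 0)) = ∏ i, g i (r i) := by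
    intro r
    simp only [g, Finset.prod_mul_distrib, splitWeight, Finset.prod_ite_eq', Finset.mem_univ,
      if_true]
  have h2 : ∏ i, ∑ c, g i c = ∑ r : Fin m → Bool, ∏ i, g i (r i) := by
    rw [Finset.prod_univ_sum, Fintype.piFinset_univ]
  have h3 : ∀ i, ∑ c, g i c = (if i = a then α else 1) *
      (if i = b then (if a = b then 1 else α) else 1) := by
    intro i
    simp only [g, Fintype.sum_bool]
    by_cases hia : i = a
    · subst hia
      by_cases hib : i = b <;> simp [hib]
    · by_cases hib : i = b
      · subst hib
        simp [hia, Ne.symm hia]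
      · simp [hia, hib]
  simp only [h1]
  rw [← h2]
  simp only [h3, Finset.prod_mul_distrib, Finset.prod_ite_eq', Finset.mem_univ, if_true]
  split_ifs <;> ring

/-- **Quadratic-moment identity:**
`E_splits[M_in·Pᵀ·M_tr·P·M_in] = α²·P̂ᵀ·P̂ + (α−α²)·diag(P̂ᵀ·P̂)`. -/
theorem expectation_min_PT_mtr_P_min (n m : ℕ) (hm : 1 ≤ m) (hmn : m ≤ n)
    (P : Matrix (Fin n) (Fin n) ℝ) (α : ℝ) (hα0 : 0 < α) (hα1 : α < 1) :
    let Mtr := trainMask n m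
    let Phat := Mtr * P * Mtr
    (∑ r : Fin m → Bool,
        splitWeight m α r • (inMask n m r * Pᵀ * Mtr * P * inMask n m r))
      = α ^ 2 • (Phatᵀ * Phat)
        + (α - α ^ 2) • (Matrix.diagonal fun i => (Phatᵀ * Phat) i i) := by
  intro Mtr Phat
  have hG : Phatᵀ * Phat = Mtr * (Pᵀ * Mtr * P) * Mtr := by
    have ht : Mtrᵀ = Mtr := by simp [Mtr, trainMask]
    have hi : Mtr * Mtr = Mtr := by simp [Mtr, trainMask]
    simp only [Phat, Matrix.transpose_mul, ht]
    calc Mtr * (Pᵀ * Mtr) * (Mtr * P * Mtr) = Mtr * Pᵀ * (Mtr * Mtr) * P * Mtr := by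
          simp only [Matrix.mul_assoc]
      _ = _ := by rw [hi]; simp only [Matrix.mul_assoc]
  have hL : ∀ r, inMask n m r * Pᵀ * Mtr * P * inMask n m r
      = inMask n m r * (Pᵀ * Mtr * P) * inMask n m r := by
    intro r; simp only [Matrix.mul_assoc]
  simp only [hL]
  rw [hG]
  generalize Pᵀ * Mtr * P = G
  ext i j
  simp only [Matrix.sum_apply, Matrix.smul_apply, Matrix.add_apply, Mtr, trainMask, inMask,
    Matrix.mul_diagonal, Matrix.diagonal_mul, smul_eq_mul, Matrix.diagonal_apply]
  by_cases hi : (i : ℕ) < m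
  · by_cases hj : (j : ℕ) < m
    · have key := moment_aux m α ⟨i, hi⟩ ⟨j, hj⟩
      simp only [hi, hj, dif_pos, if_true]
      have : ∀ r : Fin m → Bool, splitWeight m α r * ((if r ⟨i, hi⟩ then (1:ℝ) else 0) * G i j *
          (if r ⟨j, hj⟩ then (1:ℝ) else 0)) = (splitWeight m α r *
          ((if r ⟨i, hi⟩ then (1:ℝ) else 0) * (if r ⟨j, hj⟩ then (1:ℝ) else 0))) * G i j := by
        intro r; ring
      simp only [this]
      rw [← Finset.sum_mul, key]
      by_cases hij : i = j
      · subst hij; simp; ring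
      · have : (i : ℕ) ≠ j := fun h => hij (Fin.ext h)
        simp [hij, this]
    · have hij : i ≠ j := by rintro rfl; exact hj hi
      simp [hj, hij]
  · simp [hi]
end

section
/- For every z ∈ ℝ^K (K ≥ 1) and every c ∈ (0,1]: log ∑_{j=1}^K exp(c·z_j) ≥ c · log ∑_{j=1}^K exp(z_j). Consequently, for every y ∈ ℝ^K, the row-wise cross-entropy loss CE(y, z) = log ∑_{j=1}^K exp(z_j) − ∑_{j=1}^K y_j·z_j satisfies CE(y, c·z) ≥ c·CE(y, z). -/
open Finset

/-- **Log-sum-exp scaling inequality and cross-entropy scaling.**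
For `z ∈ ℝ^K` and `c ∈ (0,1]`: `log ∑_j exp(c·z_j) ≥ c·log ∑_j exp(z_j)`, and
consequently `CE(y, c·z) ≥ c·CE(y, z)` for every `y ∈ ℝ^K`, where
`CE(y,z) = log ∑_j exp(z_j) − ∑_j y_j·z_j`. -/
theorem logsumexp_cross_entropy_scaling (K : ℕ) (hK : 1 ≤ K)
    (z : Fin K → ℝ) (c : ℝ) (hc0 : 0 < c) (hc1 : c ≤ 1) :
    (Real.log (∑ j, Real.exp (c * z j)) ≥ c * Real.log (∑ j, Real.exp (z j))) ∧
    ∀ y : Fin K → ℝ,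
      (Real.log (∑ j, Real.exp (c * z j)) - ∑ j, y j * (c * z j))
        ≥ c * (Real.log (∑ j, Real.exp (z j)) - ∑ j, y j * z j) := by
  have hne : (Finset.univ : Finset (Fin K)).Nonempty := ⟨⟨0, hK⟩, Finset.mem_univ _⟩
  have hS : 0 < ∑ j, Real.exp (z j) := Finset.sum_pos (fun j _ => Real.exp_pos _) hne
  have hT : 0 < ∑ j, Real.exp (c * z j) := Finset.sum_pos (fun j _ => Real.exp_pos _) hne
  have main : c * Real.log (∑ j, Real.exp (z j)) ≤ Real.log (∑ j, Real.exp (c * z j)) := by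
    rw [Real.le_log_iff_exp_le hT]
    set L := Real.log (∑ j, Real.exp (z j)) with hL
    have hexp : Real.exp L = ∑ j, Real.exp (z j) := Real.exp_log hS
    have hle : ∀ j, z j ≤ L := fun j => by
      rw [hL, Real.le_log_iff_exp_le hS]
      exact Finset.single_le_sum (f := fun j => Real.exp (z j))
        (fun i _ => (Real.exp_pos _).le) (Finset.mem_univ j)
    calc Real.exp (c * L) = Real.exp (c * L - L) * Real.exp L := by
          rw [← Real.exp_add]; congr 1; ring
      _ = ∑ j, Real.exp (c * L - L) * Real.exp (z j) := by rw [hexp, Finset.mul_sum]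
      _ ≤ ∑ j, Real.exp (c * z j) := by
          refine Finset.sum_le_sum fun j _ => ?_
          rw [← Real.exp_add, Real.exp_le_exp]
          nlinarith [mul_nonneg (sub_nonneg.2 hc1) (sub_nonneg.2 (hle j))]
  refine ⟨main, fun y => ?_⟩
  have h : ∑ j, y j * (c * z j) = c * ∑ j, y j * z j := by
    rw [Finset.mul_sum]
    exact Finset.sum_congr rfl fun j _ => by ring
  rw [h, mul_sub]
  linarith
end
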